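/- arXiv:2203.00958 — 6 statements merged into one kernel-verified Lean document; each statement's English description precedes it below -/
import Mathlib

section
/- Let F be a finite field with q elements. For every real ε > 0 there exists an integer N such that: for every integer n > N and every code C ⊆ F^n with |C| ≥ 2 whose minimum Hamming distance min{d(c,c') : c ≠ c' ∈ C} is greater than (1 − 1/q)·n, one has log_q |C| / n < ε. -/
/-- The number of pairs of codewords agreeing in a given coordinate is at least `|C|² / |F|`. -/
theorem sq_card_le_card_mul_sum_agree {ι F : Type*} [Fintype F] [DecidableEq F]
    (C : Finset (ι → F)) (i : ι) :
    (C.card : ℝ) ^ 2 ≤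
      Fintype.card F * ∑ c ∈ C, ∑ c' ∈ C, (if c i = c' i then (1 : ℝ) else 0) := by
  have h1 : (C.card : ℝ) = ∑ a : F, ∑ c ∈ C, (if c i = a then (1 : ℝ) else 0) := by
    rw [Finset.sum_comm]
    simp
  have h2 : ∑ c ∈ C, ∑ c' ∈ C, (if c i = c' i then (1 : ℝ) else 0) =
      ∑ a : F, (∑ c ∈ C, (if c i = a then (1 : ℝ) else 0)) ^ 2 := by
    simp_rw [sq, Finset.sum_mul_sum]
    symm
    rw [Finset.sum_comm]
    refine Finset.sum_congr rfl fun c _ => ?_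
    rw [Finset.sum_comm]
    refine Finset.sum_congr rfl fun c' _ => ?_
    simp [eq_comm]
  rw [h1, h2]
  exact sq_sum_le_card_mul_sum_sq

theorem sum_agree_add_hammingDist {ι F : Type*} [Fintype ι] [DecidableEq F] (c c' : ι → F) :
    ∑ i, (if c i = c' i then (1 : ℝ) else 0) + hammingDist c c' = Fintype.card ι := by
  have h : (hammingDist c c' : ℝ) = ∑ i, (if c i = c' i then (0 : ℝ) else 1) := by
    simp [hammingDist, Finset.sum_ite]
  rw [h, ← Finset.sum_add_distrib, Finset.sum_congr rfl (g := fun _ => (1 : ℝ))]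
  · simp
  · intro i _
    split_ifs <;> simp

/-- Plotkin's bound: a code of relative minimum distance exceeding `1 - 1/q` has at most
`q * n` words. -/
theorem card_le_card_mul_of_lt_hammingDist {F : Type*} [Fintype F] [DecidableEq F] [Nonempty F]
    {n : ℕ} (hn : 0 < n) (C : Finset (Fin n → F)) (hC : 0 < C.card)
    (hd : ∀ c ∈ C, ∀ c' ∈ C, c ≠ c' →
      (1 - 1 / (Fintype.card F : ℝ)) * n < (hammingDist c c' : ℝ)) :
    (C.card : ℝ) ≤ Fintype.card F * n := by
  classical
  set q := Fintype.card F with hq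
  have hq0 : (0 : ℝ) < q := by exact_mod_cast Fintype.card_pos
  have hn1 : (1 : ℝ) ≤ n := by exact_mod_cast hn
  have hM : (0 : ℝ) < C.card := by exact_mod_cast hC
  have lower : (n : ℝ) * (C.card : ℝ) ^ 2 ≤
      q * ∑ c ∈ C, ∑ c' ∈ C, ∑ i, (if c i = c' i then (1 : ℝ) else 0) := by
    have h := Finset.sum_le_sum fun (i : Fin n) (_ : i ∈ Finset.univ) =>
      sq_card_le_card_mul_sum_agree C i
    rw [← Finset.mul_sum, Finset.sum_comm] at h
    simp_rw [Finset.sum_comm (s := Finset.univ) (t := C)] at h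
    simpa using h
  have agree : ∀ c ∈ C, ∀ c' ∈ C, q * ∑ i, (if c i = c' i then (1 : ℝ) else 0) ≤
      (n - 1) + (if c = c' then (q * n - (n - 1) : ℝ) else 0) := by
    intro c hc c' hc'
    by_cases h : c = c'
    · subst h
      simp
    · have h1 := hd c hc c' hc' h
      have h2 := sum_agree_add_hammingDist c c'
      have h3 : (q : ℝ) * n < q * hammingDist c c' + n := by
        have := mul_lt_mul_of_pos_left h1 hq0
        have e : (q : ℝ) * ((1 - 1 / (q : ℝ)) * n) = q * n - n := by field_simp
        linarith
      have h4 : (q : ℝ) * n + 1 ≤ q * hammingDist c c' + n := by exact_mod_cast h3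
      rw [if_neg h, eq_sub_of_add_eq h2]
      simp only [Fintype.card_fin]
      linarith
  have upper : q * ∑ c ∈ C, ∑ c' ∈ C, ∑ i, (if c i = c' i then (1 : ℝ) else 0) ≤
      C.card * (C.card * (n - 1) + (q * n - (n - 1))) := by
    simp_rw [Finset.mul_sum (s := C)]
    refine (Finset.sum_le_sum fun c hc => Finset.sum_le_sum fun c' hc' =>
      agree c hc c' hc').trans (le_of_eq ?_)
    rw [Finset.sum_congr rfl (g := fun _ => (C.card * (n - 1) + (q * n - (n - 1)) : ℝ))]
    · rw [Finset.sum_const, nsmul_eq_mul]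
    · intro c hc
      rw [Finset.sum_add_distrib, Finset.sum_ite_eq, if_pos hc, Finset.sum_const, nsmul_eq_mul]
  have key : (n : ℝ) * C.card ≤ C.card * (n - 1) + (q * n - (n - 1)) := by
    refine le_of_mul_le_mul_left ?_ hM
    linarith
  linarith

theorem tendsto_logb_mul_div_atTop (b : ℝ) (hb : 1 < b) :
    Filter.Tendsto (fun n : ℕ => Real.logb b (b * n) / n) Filter.atTop (nhds 0) := by
  have h1 : Filter.Tendsto (fun n : ℕ => Real.log n / n) Filter.atTop (nhds 0) :=
    Real.isLittleO_log_id_atTop.tendsto_div_nhds_zero.comp tendsto_natCast_atTop_atTop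
  have h2 : Filter.Tendsto (fun n : ℕ => (1 : ℝ) / n + Real.log n / n / Real.log b)
      Filter.atTop (nhds 0) := by
    simpa using tendsto_one_div_atTop_nhds_zero_nat.add (h1.div_const (Real.log b))
  refine h2.congr' ?_
  filter_upwards [Filter.eventually_gt_atTop 0] with n hn
  have hn' : (n : ℝ) ≠ 0 := by exact_mod_cast hn.ne'
  have hlog : Real.log b ≠ 0 := (Real.log_pos hb).ne'
  rw [Real.logb, Real.log_mul (by linarith) hn']
  field_simp

/-- Plotkin-type consequence: codes with relative minimum distance
exceeding `1 - 1/q` have rate tending to `0`. -/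
theorem statement0 (F : Type) [Field F] [Fintype F] [DecidableEq F]
    (q : ℕ) (hq : q = Fintype.card F) (ε : ℝ) (hε : 0 < ε) :
    ∃ N : ℕ, ∀ n : ℕ, N < n → ∀ C : Finset (Fin n → F), 2 ≤ C.card →
      (∀ c ∈ C, ∀ c' ∈ C, c ≠ c' → (1 - 1 / (q : ℝ)) * n < (hammingDist c c' : ℝ)) →
      Real.logb q C.card / n < ε := by
  subst hq
  have hq1 : (1 : ℝ) < Fintype.card F := by exact_mod_cast Fintype.one_lt_card
  obtain ⟨N, hN⟩ := Filter.eventually_atTop.1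
    ((tendsto_logb_mul_div_atTop _ hq1).eventually_lt_const hε)
  refine ⟨N, fun n hn C hC hd => lt_of_le_of_lt ?_ (hN n hn.le)⟩
  have hM : (0 : ℝ) < C.card := by exact_mod_cast (by omega : 0 < C.card)
  gcongr
  exact card_le_card_mul_of_lt_hammingDist (by omega) C (by omega) hd
end

section
/- Let F be a finite field with q elements and let 0 < δ < 1 − 1/q. For each integer n ≥ 1 let B_n(δ) = {a ∈ F^n : w(a) ≤ δ·n} (the Hamming ball of radius ⌊δn⌋ centred at 0). Then |B_n(δ)| ≤ q^{n·h_q(δ)} for every n ≥ 1, and lim_{n→∞} log_q |B_n(δ)| / n = h_q(δ). -/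
/-- The `q`-entropy function `h_q(δ)`. -/
noncomputable def qEntropy (q : ℕ) (δ : ℝ) : ℝ :=
  δ * Real.logb q ((q : ℝ) - 1) - δ * Real.logb q δ - (1 - δ) * Real.logb q (1 - δ)

open Finset in
/-- The Hamming weight enumerator of the full space `F^n`. -/
theorem sum_pow_hammingNorm {F R : Type*} [Fintype F] [Zero F] [DecidableEq F] [CommRing R]
    (n : ℕ) (x : R) :
    ∑ a : Fin n → F, x ^ hammingNorm a = (1 + ((Fintype.card F : R) - 1) * x) ^ n := by
  have hsum : ∑ c : F, (if c ≠ 0 then x else 1) = 1 + ((Fintype.card F : R) - 1) * x := by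
    have h : ∀ c : F, (if c ≠ 0 then x else 1) = x + if c = 0 then 1 - x else 0 := by
      intro c; split_ifs <;> simp_all
    simp only [h, sum_add_distrib, sum_const, sum_ite_eq', card_univ, mem_univ, if_true,
      nsmul_eq_mul]
    ring
  have hprod : ∏ _i : Fin n, ∑ c : F, (if c ≠ 0 then x else 1)
      = (1 + ((Fintype.card F : R) - 1) * x) ^ n := by
    rw [hsum, prod_const, card_univ, Fintype.card_fin]
  rw [← hprod, prod_univ_sum, Fintype.piFinset_univ]
  refine sum_congr rfl fun a _ ↦ ?_
  rw [prod_ite, prod_const, prod_const_one, mul_one, hammingNorm]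

open Finset Polynomial in
/-- The number of words of length `n` and Hamming weight `k`. -/
theorem card_hammingNorm_eq (F : Type*) [Fintype F] [Zero F] [DecidableEq F] (n k : ℕ) :
    (#{a : Fin n → F | hammingNorm a = k} : ℝ)
      = n.choose k * ((Fintype.card F : ℝ) - 1) ^ k := by
  have h := congrArg (fun p : ℝ[X] ↦ p.coeff k)
    (sum_pow_hammingNorm (F := F) n (X : ℝ[X]))
  have e : (1 + ((Fintype.card F : ℝ[X]) - 1) * X) ^ n
      = ((1 + X) ^ n : ℝ[X]).comp (C ((Fintype.card F : ℝ) - 1) * X) := by simp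
  simp only [e, comp_C_mul_X_coeff, coeff_one_add_X_pow, finsetSum_coeff, coeff_X_pow] at h
  simpa [eq_comm] using h

/-- The term of index `⌊δ n⌋` of the expansion of `(1 + δ / (1 - δ)) ^ n` is, up to the
factor `1 - δ`, the largest one. -/
theorem choose_mul_pow_le_floor {δ : ℝ} (h0 : 0 < δ) (h1 : δ < 1) (n j : ℕ) :
    (1 - δ) * (n.choose j * (δ / (1 - δ)) ^ j)
      ≤ n.choose ⌊δ * n⌋₊ * (δ / (1 - δ)) ^ ⌊δ * n⌋₊ := by
  have h1' : 0 < 1 - δ := by linarith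
  set k := ⌊δ * n⌋₊
  set t := δ / (1 - δ) with ht
  have ht0 : 0 < t := by positivity
  have htδ : t * (1 - δ) = δ := by rw [ht]; field_simp
  have hn0 : (0 : ℝ) ≤ n := n.cast_nonneg
  have hkle : (k : ℝ) ≤ δ * n := Nat.floor_le (by positivity)
  have hklt : δ * n < k + 1 := Nat.lt_floor_add_one _
  have hrec : ∀ i, i ≤ n → ((i : ℝ) + 1) * (1 - δ) * (n.choose (i + 1) * t ^ (i + 1))
      = ((n : ℝ) - i) * δ * (n.choose i * t ^ i) := by
    intro i hi
    have := congrArg (Nat.cast (R := ℝ)) (Nat.choose_succ_right_eq n i)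
    push_cast [Nat.cast_sub hi] at this
    rw [pow_succ]
    linear_combination t ^ i * (t * (1 - δ)) * this + n.choose i * (n - i) * t ^ i * htδ
  have hT : ∀ i, 0 ≤ (n.choose i : ℝ) * t ^ i := fun i ↦ by positivity
  have hkn : k ≤ n := by
    have : (k : ℝ) ≤ n := by nlinarith
    exact_mod_cast this
  rcases le_or_gt j k with hj | hj
  · have hmono : ∀ i, j ≤ i → i ≤ k → (n.choose j : ℝ) * t ^ j ≤ n.choose i * t ^ i := by
      intro i hi
      induction i, hi using Nat.le_induction with
      | base => exact fun _ ↦ le_rfl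
      | succ i hi ih =>
        intro hik
        refine (ih (by omega)).trans ?_
        have hik' : (i : ℝ) + 1 ≤ k := by exact_mod_cast hik
        have hpos : 0 < ((i : ℝ) + 1) * (1 - δ) := by positivity
        refine le_of_mul_le_mul_left ?_ hpos
        rw [hrec i (by omega)]
        exact mul_le_mul_of_nonneg_right (by nlinarith) (hT i)
    nlinarith [hT j, hmono k hj le_rfl]
  · induction j, hj using Nat.le_induction with
    | base =>
      have hpos : (0 : ℝ) < (k : ℝ) + 1 := by positivity
      refine le_of_mul_le_mul_left ?_ hpos
      rw [← mul_assoc, Nat.succ_eq_add_one, hrec k hkn]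
      have hk0 : (0 : ℝ) ≤ k := k.cast_nonneg
      exact mul_le_mul_of_nonneg_right (by nlinarith) (hT k)
    | succ i hi ih =>
      refine le_trans (mul_le_mul_of_nonneg_left ?_ h1'.le) ih
      rcases le_or_gt i n with hin | hin
      · have hki : (k : ℝ) + 1 ≤ i := by exact_mod_cast hi
        have hpos : 0 < ((i : ℝ) + 1) * (1 - δ) := by positivity
        refine le_of_mul_le_mul_left ?_ hpos
        rw [hrec i hin]
        exact mul_le_mul_of_nonneg_right (by nlinarith) (hT i)
      · rw [Nat.choose_eq_zero_of_lt (by omega : n < i + 1)]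
        simpa using hT i

/-- A lower bound for the largest term of the binomial expansion of `(1 + δ / (1 - δ)) ^ n`. -/
theorem le_choose_floor_mul_pow {δ : ℝ} (h0 : 0 < δ) (h1 : δ < 1) (n : ℕ) :
    (1 - δ) / (n + 1) * (1 + δ / (1 - δ)) ^ n
      ≤ n.choose ⌊δ * n⌋₊ * (δ / (1 - δ)) ^ ⌊δ * n⌋₊ := by
  rw [div_mul_eq_mul_div, div_le_iff₀ (by positivity), add_comm 1 (δ / (1 - δ)), add_pow,
    Finset.mul_sum]
  refine (Finset.sum_le_card_nsmul _ _
    (n.choose ⌊δ * n⌋₊ * (δ / (1 - δ)) ^ ⌊δ * n⌋₊) fun j _ ↦ ?_).trans_eq ?_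
  · simpa [mul_comm] using choose_mul_pow_le_floor h0 h1 n j
  · simp [mul_comm]

/-- With `r = (q - 1) (1 - δ) / δ` one has `q ^ h_q(δ) = r ^ δ * (1 + δ / (1 - δ))`. -/
theorem rpow_mul_qEntropy {q : ℕ} {δ : ℝ} (hq : 1 < q) (h0 : 0 < δ) (h1 : δ < 1) (n : ℕ) :
    (q : ℝ) ^ ((n : ℝ) * qEntropy q δ)
      = (((q : ℝ) - 1) * (1 - δ) / δ) ^ (δ * n) * (1 + δ / (1 - δ)) ^ n := by
  have hq' : (1 : ℝ) < q := by exact_mod_cast hq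
  have hq1 : (0 : ℝ) < q - 1 := by linarith
  have h1' : 0 < 1 - δ := by linarith
  have ht : 1 + δ / (1 - δ) = (1 - δ)⁻¹ := by field_simp; ring
  have hlog : Real.log q ≠ 0 := (Real.log_pos hq').ne'
  rw [ht]
  apply Real.log_injOn_pos (Set.mem_Ioi.2 (by positivity)) (Set.mem_Ioi.2 (by positivity))
  rw [Real.log_rpow (by positivity), Real.log_mul (by positivity) (by positivity),
    Real.log_rpow (by positivity), Real.log_pow, Real.log_inv,
    Real.log_div (by positivity) (by positivity), Real.log_mul (by positivity) (by positivity)]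
  simp only [qEntropy, Real.logb]
  field_simp
  ring

open Finset in
/-- The entropy bound for the size of a Hamming ball. -/
theorem card_hammingNorm_le_rpow_qEntropy (F : Type*) [Fintype F] [Zero F] [DecidableEq F]
    (hq : 1 < Fintype.card F) {δ : ℝ} (h0 : 0 < δ) (h1 : δ < 1 - 1 / (Fintype.card F : ℝ))
    (n : ℕ) :
    (#{a : Fin n → F | (hammingNorm a : ℝ) ≤ δ * n} : ℝ)
      ≤ (Fintype.card F : ℝ) ^ ((n : ℝ) * qEntropy (Fintype.card F) δ) := by
  have hq' : (1 : ℝ) < Fintype.card F := by exact_mod_cast hq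
  have hδ1 : δ < 1 := h1.trans (by simp; positivity)
  rw [rpow_mul_qEntropy hq h0 hδ1]
  set q : ℝ := (Fintype.card F : ℝ) with hqdef
  have hq1 : (0 : ℝ) < q - 1 := by linarith
  have h1' : 0 < 1 - δ := by linarith
  set r : ℝ := (q - 1) * (1 - δ) / δ with hr
  have hr0 : 0 < r := by positivity
  have hr1 : 1 ≤ r := by
    rw [hr, one_le_div h0]
    rw [lt_sub_iff_add_lt, ← lt_sub_iff_add_lt', div_lt_iff₀ (by linarith)] at h1
    linarith
  have hsum := sum_pow_hammingNorm (F := F) n r⁻¹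
  rw [← hqdef, show (q - 1) * r⁻¹ = δ / (1 - δ) by rw [hr]; field_simp] at hsum
  rw [← hsum, ← nsmul_one, ← sum_const, mul_sum]
  refine (sum_le_sum fun a ha ↦ ?_).trans
    (sum_le_sum_of_subset_of_nonneg (filter_subset _ _) fun a _ _ ↦ by positivity)
  rw [inv_pow, ← div_eq_mul_inv, one_le_div (by positivity), ← Real.rpow_natCast]
  exact Real.rpow_le_rpow_of_exponent_le hr1 (mem_filter.1 ha).2

open Finset in
/-- The entropy bound for the size of a Hamming ball is tight up to a linear factor. -/
theorem rpow_qEntropy_le_card_hammingNorm (F : Type*) [Fintype F] [Zero F] [DecidableEq F]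
    (hq : 1 < Fintype.card F) {δ : ℝ} (h0 : 0 < δ) (h1 : δ < 1 - 1 / (Fintype.card F : ℝ)) :
    ∃ c : ℝ, 0 < c ∧ ∀ n : ℕ,
      c / (n + 1) * (Fintype.card F : ℝ) ^ ((n : ℝ) * qEntropy (Fintype.card F) δ)
        ≤ #{a : Fin n → F | (hammingNorm a : ℝ) ≤ δ * n} := by
  have hq' : (1 : ℝ) < Fintype.card F := by exact_mod_cast hq
  have hδ1 : δ < 1 := h1.trans (by simp; positivity)
  simp only [rpow_mul_qEntropy hq h0 hδ1]
  have hcard := card_hammingNorm_eq F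
  set q : ℝ := (Fintype.card F : ℝ) with hqdef
  have hq1 : (0 : ℝ) < q - 1 := by linarith
  have h1' : 0 < 1 - δ := by linarith
  set r : ℝ := (q - 1) * (1 - δ) / δ with hr
  have hr0 : 0 < r := by positivity
  have hr1 : 1 ≤ r := by
    rw [hr, one_le_div h0]
    rw [lt_sub_iff_add_lt, ← lt_sub_iff_add_lt', div_lt_iff₀ (by linarith)] at h1
    linarith
  refine ⟨(1 - δ) / r, by positivity, fun n ↦ ?_⟩
  set k := ⌊δ * n⌋₊
  have hkle : (k : ℝ) ≤ δ * n := Nat.floor_le (by positivity)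
  have hpow : r ^ (δ * n) ≤ r * r ^ k := by
    rw [← pow_succ', ← Real.rpow_natCast]
    refine Real.rpow_le_rpow_of_exponent_le hr1 ?_
    push_cast
    exact (Nat.lt_floor_add_one _).le
  calc (1 - δ) / r / (n + 1) * (r ^ (δ * n) * (1 + δ / (1 - δ)) ^ n)
      ≤ (1 - δ) / r / (n + 1) * ((r * r ^ k) * (1 + δ / (1 - δ)) ^ n) := by gcongr
    _ = r ^ k * ((1 - δ) / (n + 1) * (1 + δ / (1 - δ)) ^ n) := by field_simp
    _ ≤ r ^ k * (n.choose k * (δ / (1 - δ)) ^ k) :=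
      mul_le_mul_of_nonneg_left (le_choose_floor_mul_pow h0 hδ1 n) (by positivity)
    _ = n.choose k * (q - 1) ^ k := by
      rw [mul_left_comm, ← mul_pow, hr]
      congr 2
      field_simp
    _ = #{a : Fin n → F | hammingNorm a = k} := (hcard n k).symm
    _ ≤ #{a : Fin n → F | (hammingNorm a : ℝ) ≤ δ * n} := by
      gcongr with a
      exact fun h ↦ h ▸ hkle

/-- the Hamming ball of relative radius `δ` has at most `q^{n h_q(δ)}`
elements, and `log_q` of its cardinality divided by `n` converges to `h_q(δ)`. -/
theorem statement1 (F : Type) [Field F] [Fintype F] [DecidableEq F]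
    (q : ℕ) (hq : q = Fintype.card F) (δ : ℝ) (hδ0 : 0 < δ) (hδ1 : δ < 1 - 1 / (q : ℝ)) :
    (∀ n : ℕ, 1 ≤ n →
      (({a : Fin n → F | (hammingNorm a : ℝ) ≤ δ * n}.ncard : ℝ))
        ≤ (q : ℝ) ^ ((n : ℝ) * qEntropy q δ)) ∧
    Filter.Tendsto
      (fun n : ℕ =>
        Real.logb q ({a : Fin n → F | (hammingNorm a : ℝ) ≤ δ * n}.ncard) / n)
      Filter.atTop (nhds (qEntropy q δ)) := by
  subst hq
  have hq : 1 < Fintype.card F := Fintype.one_lt_card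
  have hq' : (1 : ℝ) < Fintype.card F := by exact_mod_cast hq
  have hq0 : (0 : ℝ) < Fintype.card F := by linarith
  have hncard : ∀ n : ℕ, {a : Fin n → F | (hammingNorm a : ℝ) ≤ δ * n}.ncard
      = (Finset.univ.filter fun a : Fin n → F ↦ (hammingNorm a : ℝ) ≤ δ * n).card := by
    intro n
    rw [← Set.ncard_coe_finset]
    simp
  simp only [hncard]
  have hupper := card_hammingNorm_le_rpow_qEntropy F hq hδ0 hδ1
  obtain ⟨c, hc, hlower⟩ := rpow_qEntropy_le_card_hammingNorm F hq hδ0 hδ1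
  refine ⟨fun n _ ↦ hupper n, ?_⟩
  have hlim : Filter.Tendsto (fun n : ℕ ↦ (Real.log c - Real.log ((n : ℝ) + 1)) /
      Real.log (Fintype.card F) / n + qEntropy (Fintype.card F) δ)
      Filter.atTop (nhds (qEntropy (Fintype.card F) δ)) := by
    have hlog : Filter.Tendsto (fun n : ℕ ↦ Real.log ((n : ℝ) + 1) / n) Filter.atTop (nhds 0) := by
      simpa [Function.comp_def] using (Real.tendsto_pow_log_div_mul_add_atTop 1 (-1) 1 one_ne_zero).comp
        (Filter.tendsto_atTop_add_const_right _ 1 tendsto_natCast_atTop_atTop)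
    have hconst := tendsto_const_div_atTop_nhds_zero_nat (Real.log c)
    have := ((hconst.sub hlog).div_const (Real.log (Fintype.card F))).add_const
      (qEntropy (Fintype.card F) δ)
    simp only [sub_zero, zero_div, zero_add] at this
    exact this.congr fun n ↦ by ring
  refine tendsto_of_tendsto_of_tendsto_of_le_of_le' hlim tendsto_const_nhds ?_ ?_
  · filter_upwards [Filter.eventually_gt_atTop 0] with n hn
    have hn' : (0 : ℝ) < n := by exact_mod_cast hn
    rw [le_div_iff₀ hn', add_mul, div_mul_cancel₀ _ hn'.ne']
    refine le_trans (le_of_eq ?_) (Real.logb_le_logb_of_le hq' (by positivity) (hlower n))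
    rw [Real.logb_mul (by positivity) (by positivity), Real.logb_rpow hq0 hq'.ne',
      Real.logb, Real.log_div hc.ne' (by positivity), mul_comm (n : ℝ)]
  · filter_upwards [Filter.eventually_gt_atTop 0] with n hn
    have hn' : (0 : ℝ) < n := by exact_mod_cast hn
    rw [div_le_iff₀ hn', mul_comm (qEntropy _ _), ← Real.logb_rpow (b := Fintype.card F)
      (x := n * qEntropy (Fintype.card F) δ) hq0 hq'.ne']
    refine Real.logb_le_logb_of_le hq' (lt_of_lt_of_le (by positivity) (hlower n)) (hupper n)
end

section
/- Let F be a finite field with q elements, n ≥ 1, and let B ⊆ F^n be a nonempty subset. Let ω = (Σ_{b∈B} w(b)) / (n·|B|) be the average relative weight of B. If 0 ≤ ω ≤ 1 − 1/q, then |B| ≤ q^{n·h_q(ω)}. -/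
/-- The Gibbs inequality: if positive weights on a finite set have total at most one, then the
cardinality is bounded through the sum of their logarithms. -/
theorem card_mul_log_card_add_sum_log_nonpos {α : Type*} (s : Finset α) (hs : s.Nonempty)
    (p : α → ℝ) (hp : ∀ a ∈ s, 0 < p a) (hsum : ∑ a ∈ s, p a ≤ 1) :
    (s.card : ℝ) * Real.log s.card + ∑ a ∈ s, Real.log (p a) ≤ 0 := by
  have hc : (0 : ℝ) < s.card := by exact_mod_cast hs.card_pos
  have hle : ∑ a ∈ s, (Real.log s.card + Real.log (p a)) ≤ ∑ a ∈ s, (s.card * p a - 1) := by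
    refine Finset.sum_le_sum fun a ha => ?_
    rw [← Real.log_mul hc.ne' (hp a ha).ne']
    exact Real.log_le_sub_one_of_pos (mul_pos hc (hp a ha))
  simp only [Finset.sum_add_distrib, Finset.sum_sub_distrib, Finset.sum_const, nsmul_eq_mul,
    ← Finset.mul_sum, mul_one] at hle
  nlinarith [mul_le_mul_of_nonneg_left hsum hc.le]

/-- The total weight of the words of length `n`, each word weighted by the product of `x` for its zero
coordinates and `y` for its nonzero ones. -/
theorem sum_prod_ite_eq_pow {F : Type*} [Zero F] [Fintype F] [DecidableEq F] (n : ℕ) (x y : ℝ) :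
    ∑ a : Fin n → F, ∏ i, (if a i = 0 then x else y) =
      (x + ((Fintype.card F : ℝ) - 1) * y) ^ n := by
  have h := Finset.prod_univ_sum (fun _ : Fin n => (Finset.univ : Finset F))
    (fun _ c => if c = 0 then x else y)
  rw [Fintype.piFinset_univ] at h
  rw [← h, Finset.prod_const, Finset.card_univ, Fintype.card_fin]
  congr 1
  rw [← Finset.add_sum_erase _ _ (Finset.mem_univ (0 : F)), if_pos rfl,
    Finset.sum_congr rfl fun c hc => if_neg (Finset.ne_of_mem_erase hc), Finset.sum_const,
    nsmul_eq_mul, Finset.cast_card_erase_of_mem (Finset.mem_univ _), Finset.card_univ]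

theorem log_prod_ite_eq_hammingNorm {F : Type*} [Zero F] [DecidableEq F] {n : ℕ}
    {x y : ℝ} (hx : 0 < x) (hy : 0 < y) (a : Fin n → F) :
    Real.log (∏ i, (if a i = 0 then x else y)) =
      n * Real.log x + hammingNorm a * (Real.log y - Real.log x) := by
  rw [Real.log_prod fun i _ => by split_ifs <;> positivity]
  have h : ∀ i, Real.log (if a i = 0 then x else y) =
      Real.log x + if a i ≠ 0 then Real.log y - Real.log x else 0 := by
    intro i
    by_cases hi : a i = 0 <;> simp [hi]
  simp only [h, Finset.sum_add_distrib, ← Finset.sum_filter, Finset.sum_const, nsmul_eq_mul,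
    Finset.card_univ, Fintype.card_fin, hammingNorm]

/-- if `B ⊆ F^n` is nonempty with average relative weight
`ω ≤ 1 - 1/q`, then `|B| ≤ q^{n·h_q(ω)}`. -/
theorem statement5 (F : Type) [Field F] [Fintype F] [DecidableEq F]
    (q : ℕ) (hq : q = Fintype.card F) (n : ℕ) (hn : 1 ≤ n)
    (B : Finset (Fin n → F)) (hB : B.Nonempty) (ω : ℝ)
    (hω : ω = (∑ b ∈ B, (hammingNorm b : ℝ)) / ((n : ℝ) * B.card))
    (hω0 : 0 ≤ ω) (hω1 : ω ≤ 1 - 1 / (q : ℝ)) :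
    (B.card : ℝ) ≤ (q : ℝ) ^ ((n : ℝ) * qEntropy q ω) := by
  have hq1 : (1 : ℝ) < q := by
    rw [hq]
    exact_mod_cast Fintype.one_lt_card
  have hq0 : (0 : ℝ) < q - 1 := by linarith
  have hc : (0 : ℝ) < B.card := by exact_mod_cast hB.card_pos
  have hn0 : (0 : ℝ) < n := by exact_mod_cast hn
  have hw : ∑ b ∈ B, (hammingNorm b : ℝ) = ω * (n * B.card) := by
    rw [hω, div_mul_cancel₀ _ (by positivity)]
  rcases hω0.eq_or_lt with h0 | hpos
  · subst h0
    rw [zero_mul, Finset.sum_eq_zero_iff_of_nonneg fun _ _ => Nat.cast_nonneg _] at hw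
    have hle : B.card ≤ 1 := by
      refine Finset.card_le_one.mpr fun a ha b hb => ?_
      rw [hammingNorm_eq_zero.mp (Nat.cast_eq_zero.mp (hw a ha)),
        hammingNorm_eq_zero.mp (Nat.cast_eq_zero.mp (hw b hb))]
    simpa [qEntropy] using hle
  · have hlt : 0 < 1 - ω := by
      have : 0 < 1 / (q : ℝ) := by positivity
      linarith
    have hy : 0 < ω / (q - 1) := by positivity
    have hprod : ∀ a : Fin n → F, 0 < ∏ i, (if a i = 0 then 1 - ω else ω / (q - 1)) := fun a =>
      Finset.prod_pos fun i _ => by split_ifs <;> assumption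
    have hsum : ∑ a ∈ B, ∏ i, (if a i = 0 then 1 - ω else ω / (q - 1)) ≤ 1 := by
      refine (Finset.sum_le_univ_sum_of_nonneg fun a => (hprod a).le).trans_eq ?_
      rw [sum_prod_ite_eq_pow, ← hq, mul_div_cancel₀ _ hq0.ne', sub_add_cancel, one_pow]
    have key := card_mul_log_card_add_sum_log_nonpos B hB _ (fun a _ => hprod a) hsum
    simp only [log_prod_ite_eq_hammingNorm hlt hy, Finset.sum_add_distrib, ← Finset.sum_mul,
      Finset.sum_const, nsmul_eq_mul, hw, Real.log_div hpos.ne' hq0.ne'] at key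
    have hlogq : 0 < Real.log q := Real.log_pos hq1
    have hent : qEntropy q ω * Real.log q =
        ω * Real.log (q - 1) - ω * Real.log ω - (1 - ω) * Real.log (1 - ω) := by
      simp only [qEntropy, Real.logb]
      field_simp
    rw [← Real.log_le_log_iff hc (by positivity), Real.log_rpow (by positivity), mul_assoc, hent]
    refine le_of_mul_le_mul_left ?_ hc
    linear_combination key
end

section
/- Let F be a finite field with q elements and let C ⊆ F^n be a balanced code of length n with information length k. Let B ⊆ C be nonempty and let ω = (Σ_{b∈B} w(b)) / (n·|B|) be the average relative weight of B. If 0 ≤ ω ≤ 1 − 1/q, then |B| ≤ q^{k·h_q(ω)}. -/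
/-- `I : κ → Finset ι` is a balanced system of information index sets of the code
`C ⊆ F^ι` with information length `k`: each `I j` has `k` elements, each coordinate
lies in exactly `t ≥ 1` of the sets `I j`, and each coordinate projection
`F^ι → F^{I j}` maps `C` bijectively onto the full space `F^{I j}`. -/
def IsBalancedSystem {F ι κ : Type*} [Fintype ι] [DecidableEq ι] [Fintype κ]
    (k : ℕ) (C : Set (ι → F)) (I : κ → Finset ι) : Prop :=
  (∀ j, (I j).card = k) ∧
  (∃ t : ℕ, 1 ≤ t ∧ ∀ i : ι, (Finset.univ.filter fun j : κ => i ∈ I j).card = t) ∧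
  (∀ j, Set.BijOn (fun c : ι → F => fun i : (I j : Finset ι) => c i.1) C Set.univ)

/-- `C ⊆ F^ι` is a balanced code with information length `k`. -/
def IsBalancedCode {F ι : Type*} [Fintype ι] [DecidableEq ι]
    (k : ℕ) (C : Set (ι → F)) : Prop :=
  ∃ (s : ℕ) (I : Fin s → Finset ι), IsBalancedSystem k C I

open Finset in
/-- Double counting: summing over the members of a system of sets that covers every point
exactly `t` times gives `t` times the total sum. -/
theorem sum_sum_of_card_filter_mem_eq {ι κ : Type*} [Fintype ι] [DecidableEq ι] [Fintype κ]
    {I : κ → Finset ι} {t : ℕ} (ht : ∀ i, (univ.filter fun j => i ∈ I j).card = t)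
    (f : ι → ℝ) : ∑ j, ∑ i ∈ I j, f i = t * ∑ i, f i := by
  have h : ∀ j, ∑ i ∈ I j, f i = ∑ i, if i ∈ I j then f i else 0 := fun j => by simp
  simp_rw [h]
  rw [sum_comm, mul_sum]
  refine sum_congr rfl fun i _ => ?_
  rw [← sum_filter, sum_const, ht, nsmul_eq_mul]

open Finset in
/-- If the coordinates in `J` determine the words of `B`, the total mass of `B` under the product
of copies of a probability weight `p` over `J` is at most one. -/
theorem sum_prod_le_one_of_injOn {F ι : Type*} [Fintype F] {p : F → ℝ}
    (hp : ∀ a, 0 ≤ p a) (hp1 : ∑ a, p a = 1) (J : Finset ι) (B : Finset (ι → F))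
    (hB : Set.InjOn (fun c : ι → F => fun i : J => c i.1) B) :
    ∑ b ∈ B, ∏ i ∈ J, p (b i) ≤ 1 := by
  classical
  calc ∑ b ∈ B, ∏ i ∈ J, p (b i)
      = ∑ b ∈ B, ∏ i : J, p (b i) := sum_congr rfl fun b _ => (prod_coe_sort J _).symm
    _ = ∑ x ∈ B.image fun c : ι → F => fun i : J => c i.1, ∏ i, p (x i) :=
        (sum_image (f := fun x : J → F => ∏ i, p (x i)) hB).symm
    _ ≤ ∑ x : J → F, ∏ i, p (x i) :=
        sum_le_sum_of_subset_of_nonneg (subset_univ _) fun x _ _ => prod_nonneg fun i _ => hp _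
    _ = 1 := by
        rw [← Fintype.prod_sum fun (_ : J) a => p a]
        simp [hp1]

open Finset in
/-- Gibbs' inequality for the uniform distribution on `B` against a subprobability weight. -/
theorem card_mul_log_card_add_sum_log_nonpos_s6 {α : Type*} (B : Finset α) (hB : B.Nonempty)
    {P : α → ℝ} (hP : ∀ b, 0 < P b) (hP1 : ∑ b ∈ B, P b ≤ 1) :
    B.card * Real.log B.card + ∑ b ∈ B, Real.log (P b) ≤ 0 := by
  have hc : (0 : ℝ) < B.card := by exact_mod_cast hB.card_pos
  have h : ∑ b ∈ B, (Real.log B.card + Real.log (P b)) ≤ ∑ b ∈ B, (B.card * P b - 1) :=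
    sum_le_sum fun b _ => by
      rw [← Real.log_mul hc.ne' (hP b).ne']
      exact Real.log_le_sub_one_of_pos (mul_pos hc (hP b))
  rw [sum_add_distrib, sum_sub_distrib, ← mul_sum] at h
  simp only [sum_const, nsmul_eq_mul, mul_one] at h
  nlinarith

open Finset in
/-- A sum over coordinates of a function that only depends on whether the coordinate vanishes. -/
theorem sum_ite_eq_zero_eq_hammingNorm {F : Type*} [Zero F] [DecidableEq F] {n : ℕ}
    (b : Fin n → F) (x y : ℝ) :
    ∑ i, (if b i = 0 then x else y) = hammingNorm b * y + (n - hammingNorm b) * x := by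
  have h : ∀ i, (if b i = 0 then x else y) = x + if b i ≠ 0 then y - x else 0 := fun i => by
    by_cases hb : b i = 0 <;> simp [hb]
  simp_rw [h]
  rw [sum_add_distrib, ← sum_filter]
  simp only [sum_const, nsmul_eq_mul, card_univ, Fintype.card_fin, hammingNorm]
  ring

open Finset in
theorem IsBalancedSystem.card_mul_log_card_le {F κ : Type*} [Field F] [Fintype F] [DecidableEq F]
    [Fintype κ] {n k : ℕ} {C : Set (Fin n → F)} {I : κ → Finset (Fin n)}
    (hI : IsBalancedSystem k C I) (hn : 0 < n) {B : Finset (Fin n → F)} (hBC : ↑B ⊆ C)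
    (hB : B.Nonempty) {p : F → ℝ} (hp : ∀ a, 0 < p a) (hp1 : ∑ a, p a = 1) :
    n * (B.card * Real.log B.card) + k * ∑ b ∈ B, ∑ i, Real.log (p (b i)) ≤ 0 := by
  obtain ⟨hk, ⟨t, ht1, ht⟩, hbij⟩ := hI
  have hj : ∀ j, B.card * Real.log B.card + ∑ b ∈ B, ∑ i ∈ I j, Real.log (p (b i)) ≤ 0 := by
    intro j
    have h := card_mul_log_card_add_sum_log_nonpos_s6 B hB (P := fun b => ∏ i ∈ I j, p (b i))
      (fun b => prod_pos fun i _ => hp _)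
      (sum_prod_le_one_of_injOn (fun a => (hp a).le) hp1 (I j) B ((hbij j).injOn.mono hBC))
    simpa only [Real.log_prod fun i _ => (hp _).ne'] using h
  have hcount : (Fintype.card κ : ℝ) * k = t * n := by
    have h := sum_sum_of_card_filter_mem_eq ht fun _ => 1
    simpa [hk] using h
  have hsum := sum_nonpos fun j (_ : j ∈ univ) => hj j
  rw [sum_add_distrib, sum_comm] at hsum
  simp_rw [sum_sum_of_card_filter_mem_eq ht] at hsum
  rw [sum_const, card_univ, nsmul_eq_mul, ← mul_sum] at hsum
  have ht0 : (0 : ℝ) < t := by exact_mod_cast ht1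
  have hn0 : (0 : ℝ) < n := by exact_mod_cast hn
  have hs : (0 : ℝ) < Fintype.card κ := by
    have h : (0 : ℝ) < Fintype.card κ * k := hcount ▸ mul_pos ht0 hn0
    exact pos_of_mul_pos_left h (Nat.cast_nonneg k)
  refine nonpos_of_mul_nonpos_right (a := (Fintype.card κ : ℝ)) ?_ hs
  calc _ = n * (Fintype.card κ * (B.card * Real.log B.card)
        + t * ∑ b ∈ B, ∑ i, Real.log (p (b i))) := by
        linear_combination (∑ b ∈ B, ∑ i, Real.log (p (b i))) * hcount
    _ ≤ 0 := mul_nonpos_of_nonneg_of_nonpos hn0.le hsum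

/-- if `C` is a balanced code of information length `k` and `B ⊆ C` is
nonempty with average relative weight `ω ≤ 1 - 1/q`, then `|B| ≤ q^{k·h_q(ω)}`. -/
theorem statement6 (F : Type) [Field F] [Fintype F] [DecidableEq F]
    (q n k : ℕ) (hq : q = Fintype.card F)
    (C : Set (Fin n → F)) (hC : IsBalancedCode k C)
    (B : Finset (Fin n → F)) (hBC : ↑B ⊆ C) (hB : B.Nonempty) (ω : ℝ)
    (hω : ω = (∑ b ∈ B, (hammingNorm b : ℝ)) / ((n : ℝ) * B.card))
    (hω0 : 0 ≤ ω) (hω1 : ω ≤ 1 - 1 / (q : ℝ)) :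
    (B.card : ℝ) ≤ (q : ℝ) ^ ((k : ℝ) * qEntropy q ω) := by
  subst hq
  have hq1 : (1 : ℝ) < Fintype.card F := by exact_mod_cast Fintype.one_lt_card (α := F)
  have hc : (0 : ℝ) < B.card := by exact_mod_cast hB.card_pos
  have hω1' : ω < 1 := by
    have : 0 < 1 / (Fintype.card F : ℝ) := by positivity
    linarith
  rcases n.eq_zero_or_pos with rfl | hn
  · have hω' : ω = 0 := by simpa using hω
    have h1 : B.card ≤ 1 := Finset.card_le_one_of_subsingleton B
    simpa [hω', qEntropy] using h1
  have hn0 : (0 : ℝ) < n := by exact_mod_cast hn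
  have hsum : ∑ b ∈ B, (hammingNorm b : ℝ) = ω * (n * B.card) := by
    rw [hω, div_mul_cancel₀ _ (by positivity)]
  rcases hω0.eq_or_lt with rfl | hpos
  · rw [zero_mul, Finset.sum_eq_zero_iff_of_nonneg fun b _ => Nat.cast_nonneg _] at hsum
    have h1 : B.card ≤ 1 := Finset.card_le_one.2 fun a ha b hb => by
      rw [hammingNorm_eq_zero.1 (Nat.cast_eq_zero.1 (hsum a ha)),
        hammingNorm_eq_zero.1 (Nat.cast_eq_zero.1 (hsum b hb))]
    simpa [qEntropy] using h1
  set Q : ℝ := (Fintype.card F : ℝ) with hQ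
  have hQ1 : 0 < Q - 1 := sub_pos.2 hq1
  obtain ⟨s, I, hI⟩ := hC
  have key := hI.card_mul_log_card_le hn hBC hB
    (p := fun a => if a = 0 then 1 - ω else ω / (Q - 1))
    (fun a => by
      split_ifs
      · linarith
      · positivity)
    (by
      have h : ∀ a : F, (if a = 0 then 1 - ω else ω / (Q - 1))
          = ω / (Q - 1) + if a = 0 then 1 - ω - ω / (Q - 1) else 0 := fun a => by
        split_ifs <;> ring
      simp_rw [h]
      rw [Finset.sum_add_distrib, Finset.sum_ite_eq' Finset.univ (0 : F)]
      simp only [Finset.sum_const, Finset.card_univ, nsmul_eq_mul, Finset.mem_univ, if_true, ← hQ]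
      field_simp
      ring)
  simp only [apply_ite Real.log, sum_ite_eq_zero_eq_hammingNorm] at key
  rw [Finset.sum_add_distrib, ← Finset.sum_mul, ← Finset.sum_mul, Finset.sum_sub_distrib, hsum,
    Real.log_div hpos.ne' hQ1.ne'] at key
  simp only [Finset.sum_const, nsmul_eq_mul] at key
  have hlogQ : 0 < Real.log Q := Real.log_pos hq1
  have hent : qEntropy (Fintype.card F) ω * Real.log Q
      = ω * Real.log (Q - 1) - ω * Real.log ω - (1 - ω) * Real.log (1 - ω) := by
    simp only [qEntropy, Real.logb, ← hQ]
    field_simp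
  rw [← Real.log_le_log_iff hc (Real.rpow_pos_of_pos (by linarith) _),
    Real.log_rpow (by linarith), mul_assoc, hent, ← sub_nonpos]
  refine nonpos_of_mul_nonpos_right (a := (n * B.card : ℝ)) ?_ (mul_pos hn0 hc)
  linarith
end

section
/- Let F be a finite field with q elements and G an abelian group of order n > 1 with gcd(n,q) = 1. Let e_0 = (1/n)·Σ_{x∈G} x ∈ FG, so that F·e_0 is a one-dimensional (minimal) ideal of FG. Then the minimum of dim_F I, taken over all minimal nonzero ideals I of FG with I ≠ F·e_0, equals μ_q(n). -/
/-- `μ_q(n)`: the minimal size of a `q`-coset of `ℤ/nℤ` (an orbit of multiplication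
by `q`) other than `{0}`. -/
noncomputable def muq (q n : ℕ) : ℕ :=
  sInf { k | ∃ a : ZMod n, a ≠ 0 ∧
    {b : ZMod n | ∃ i : ℕ, b = a * (q : ZMod n) ^ i}.ncard = k }

/-- The size of a nonzero `q`-coset of `ℤ/nℤ` is a positive exponent `m` such that `q ^ m ≡ 1`
modulo some prime divisor of `n`. -/
theorem exists_prime_dvd_pow_ncard_coset {q n : ℕ} (h1 : 1 < n) (hcop : n.Coprime q)
    {a : ZMod n} (ha : a ≠ 0) :
    let m := {b : ZMod n | ∃ i : ℕ, b = a * (q : ZMod n) ^ i}.ncard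
    0 < m ∧ ∃ p : ℕ, p.Prime ∧ p ∣ n ∧ q ^ m ≡ 1 [MOD p] := by
  intro m
  have : NeZero n := ⟨by omega⟩
  have hqn : q ^ n.totient ≡ 1 [MOD n] := Nat.ModEq.pow_totient hcop.symm
  have hiter (i : ℕ) : (fun x : ZMod n => x * (q : ZMod n))^[i] a = a * (q : ZMod n) ^ i := by
    induction i with
    | zero => simp
    | succ i ih => rw [Function.iterate_succ_apply', ih, pow_succ, mul_assoc]
  set f : ZMod n → ZMod n := fun x => x * (q : ZMod n) with hf
  have hper : a ∈ Function.periodicPts f := by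
    refine ⟨n.totient, Nat.totient_pos.2 (by omega), ?_⟩
    have h := (ZMod.natCast_eq_natCast_iff _ _ _).2 hqn
    push_cast at h
    rw [Function.IsPeriodicPt, Function.IsFixedPt, hiter, h, mul_one]
  have hpos := Function.minimalPeriod_pos_of_mem_periodicPts hper
  have hset : {b : ZMod n | ∃ i : ℕ, b = a * (q : ZMod n) ^ i} =
      (fun i => f^[i] a) '' Set.Iio (Function.minimalPeriod f a) := by
    ext b
    constructor
    · rintro ⟨i, rfl⟩
      refine ⟨i % Function.minimalPeriod f a, Nat.mod_lt _ hpos, ?_⟩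
      simp only
      rw [Function.iterate_mod_minimalPeriod_eq, hiter]
    · rintro ⟨i, -, rfl⟩
      exact ⟨i, hiter i⟩
  have hm : m = Function.minimalPeriod f a := by
    simp only [m]
    rw [hset, Set.InjOn.ncard_image Function.iterate_injOn_Iio_minimalPeriod]
    simp [← Finset.coe_Iio, Set.ncard_coe_finset]
  have hfix : a * (q : ZMod n) ^ m = a := by
    rw [← hiter, hm]
    exact Function.isPeriodicPt_minimalPeriod f a
  refine ⟨hm ▸ hpos, (addOrderOf a).minFac, Nat.minFac_prime ?_, ?_, ?_⟩
  · simpa using ha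
  · refine (Nat.minFac_dvd _).trans (addOrderOf_dvd_of_nsmul_eq_zero ?_)
    simp
  · refine Nat.ModEq.of_dvd (Nat.minFac_dvd _) ?_
    rw [← nsmul_eq_nsmul_iff_modEq, one_nsmul, nsmul_eq_mul]
    push_cast
    rw [mul_comm, hfix]

/-- If `q ^ d ≡ 1` modulo a prime divisor of `n`, then some nonzero `q`-coset of `ℤ/nℤ` has at
most `d` elements. -/
theorem muq_le_of_pow_modEq_one {q n p d : ℕ} (h1 : 1 < n) (hp : p.Prime) (hpn : p ∣ n)
    (hd : 0 < d) (hqd : q ^ d ≡ 1 [MOD p]) : muq q n ≤ d := by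
  obtain ⟨t, rfl⟩ := hpn
  have ht : 0 < t := Nat.pos_of_ne_zero (by rintro rfl; simp at h1)
  have ha : (t : ZMod (p * t)) ≠ 0 := by
    rw [Ne, ZMod.natCast_eq_zero_iff]
    intro h
    have := Nat.le_of_dvd ht h
    nlinarith [hp.two_le]
  have hfix : (t : ZMod (p * t)) * (q : ZMod (p * t)) ^ d = t := by
    have h : t * q ^ d ≡ t * 1 [MOD (t * p)] := Nat.ModEq.mul_left' t hqd
    rw [mul_comm t p, mul_one] at h
    exact_mod_cast (ZMod.natCast_eq_natCast_iff _ _ _).2 h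
  have hfix' (j : ℕ) : (t : ZMod (p * t)) * ((q : ZMod (p * t)) ^ d) ^ j = t := by
    induction j with
    | zero => simp
    | succ j ih => rw [pow_succ, ← mul_assoc, ih, hfix]
  refine le_trans (b := {b : ZMod (p * t) | ∃ i : ℕ, b = t * (q : ZMod (p * t)) ^ i}.ncard)
    (Nat.sInf_le ⟨(t : ZMod (p * t)), ha, rfl⟩) ?_
  have hsub : {b : ZMod (p * t) | ∃ i : ℕ, b = t * (q : ZMod (p * t)) ^ i} ⊆
      ((Finset.range d).image fun i => (t : ZMod (p * t)) * (q : ZMod (p * t)) ^ i :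
        Finset (ZMod (p * t))) := by
    rintro b ⟨i, rfl⟩
    simp only [Finset.coe_image, Set.mem_image, Finset.coe_range, Set.mem_Iio]
    refine ⟨i % d, Nat.mod_lt _ hd, ?_⟩
    conv_rhs => rw [← Nat.div_add_mod i d, pow_add, pow_mul, ← mul_assoc, hfix']
  refine (Set.ncard_le_ncard hsub (Finset.finite_toSet _)).trans ?_
  rw [Set.ncard_coe_finset]
  exact Finset.card_image_le.trans (Finset.card_range d).le

/-- An element of a commutative ring fixing a nonzero element of a minimal ideal fixes the whole
ideal. -/
theorem mul_eq_self_of_isAtom {R : Type*} [CommRing R] {I : Ideal R} (hI : IsAtom I) {x v : R}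
    (hv : v ∈ I) (hv0 : v ≠ 0) (hxv : x * v = v) {w : R} (hw : w ∈ I) : x * w = w := by
  have hspan : Ideal.span {v} = I :=
    (hI.le_iff_eq (by simpa using hv0)).1 ((Ideal.span_singleton_le_iff_mem I).2 hv)
  rw [← hspan] at hw
  obtain ⟨c, rfl⟩ := Ideal.mem_span_singleton'.1 hw
  rw [mul_left_comm, hxv]

section GroupAlgebra

variable {F G : Type*} [Field F] [CommGroup G] [Fintype G]

/-- If `G` acts trivially on a minimal ideal of its group algebra, that ideal is generated by the
averaging idempotent. -/
theorem eq_span_average_of_trivial (hn : (Fintype.card G : F) ≠ 0)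
    {I : Ideal (MonoidAlgebra F G)} (hI : IsAtom I)
    (htriv : ∀ g : G, ∀ v ∈ I, MonoidAlgebra.of F G g * v = v) :
    I = Ideal.span {(Fintype.card G : F)⁻¹ • ∑ x : G, MonoidAlgebra.of F G x} := by
  set e : MonoidAlgebra F G := (Fintype.card G : F)⁻¹ • ∑ x : G, MonoidAlgebra.of F G x with he
  have hge (g : G) : MonoidAlgebra.of F G g * e = e := by
    rw [he, mul_smul_comm, Finset.mul_sum]
    congr 1
    simp_rw [← map_mul]
    exact Fintype.sum_equiv (Equiv.mulLeft g) _ _ fun x => rfl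
  have hce (a : MonoidAlgebra F G) : ∃ c : F, a * e = c • e := by
    induction a using MonoidAlgebra.induction_on with
    | of g => exact ⟨1, by rw [hge, one_smul]⟩
    | add a b ha hb =>
      obtain ⟨c, hc⟩ := ha
      obtain ⟨d, hd⟩ := hb
      exact ⟨c + d, by rw [add_mul, hc, hd, add_smul]⟩
    | smul r a ha =>
      obtain ⟨c, hc⟩ := ha
      exact ⟨r * c, by rw [smul_mul_assoc, hc, mul_smul]⟩
  have hev (v : MonoidAlgebra F G) (hv : v ∈ I) : v * e = v := by
    rw [mul_comm, he, smul_mul_assoc, Finset.sum_mul, Finset.sum_congr rfl fun x _ => htriv x v hv,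
      Finset.sum_const, Finset.card_univ, ← Nat.cast_smul_eq_nsmul F, inv_smul_smul₀ hn]
  obtain ⟨v, hv, hv0⟩ := Submodule.exists_mem_ne_zero_of_ne_bot hI.1
  refine le_antisymm (fun w hw => Ideal.mem_span_singleton'.2 ⟨w, hev w hw⟩) ?_
  rw [Ideal.span_singleton_le_iff_mem]
  obtain ⟨c, hc⟩ := hce v
  rw [hev v hv] at hc
  have hc0 : c ≠ 0 := by
    rintro rfl
    exact hv0 (by rw [hc, zero_smul])
  have : e = c⁻¹ • v := by rw [hc, inv_smul_smul₀ hc0]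
  rw [this]
  exact (I.restrictScalars F).smul_mem _ hv

/-- A finite minimal ideal on which `G` acts nontrivially has cardinality `1` modulo some prime
divisor of the order of `G`. -/
theorem exists_prime_card_modEq_one {I : Ideal (MonoidAlgebra F G)} [Finite I] (hI : IsAtom I)
    {g : G} {v : MonoidAlgebra F G} (hv : v ∈ I) (hgv : MonoidAlgebra.of F G g * v ≠ v) :
    ∃ p : ℕ, p.Prime ∧ p ∣ Fintype.card G ∧ Nat.card I ≡ 1 [MOD p] := by
  classical
  have := Fintype.ofFinite I
  let ρ : G →* Module.End (MonoidAlgebra F G) I :=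
    (algebraMap (MonoidAlgebra F G) (Module.End (MonoidAlgebra F G) I) : _ →* _).comp
      (MonoidAlgebra.of F G)
  have hρ (h : G) (w : I) : ((ρ h w : I) : MonoidAlgebra F G) = MonoidAlgebra.of F G h * w := rfl
  have hdvd : orderOf (ρ g) ∣ Fintype.card G :=
    orderOf_dvd_of_pow_eq_one (by rw [← map_pow, pow_card_eq_one, map_one])
  have hne : orderOf (ρ g) ≠ 1 := by
    rw [Ne, orderOf_eq_one_iff]
    intro h
    apply hgv
    rw [← hρ g ⟨v, hv⟩, h]
    rfl
  have hpos : 0 < orderOf (ρ g) := Nat.pos_of_dvd_of_pos hdvd Fintype.card_pos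
  set p := (orderOf (ρ g)).minFac with hp
  have hpp : p.Prime := Nat.minFac_prime hne
  have : Fact p.Prime := ⟨hpp⟩
  refine ⟨p, hpp, (Nat.minFac_dvd _).trans hdvd, ?_⟩
  set h : G := g ^ (orderOf (ρ g) / p) with hh
  have hord : orderOf (ρ h) = p := by
    rw [hh, map_pow, orderOf_pow_orderOf_div hpos.ne' (Nat.minFac_dvd _)]
  have hpow : ρ h ^ p = 1 := by rw [← hord, pow_orderOf_eq_one]
  let f : Function.End I := fun w => ρ h w
  have hf : f ^ p ^ 1 = 1 := by
    have hk (k : ℕ) : f ^ k = fun w => (ρ h ^ k) w := by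
      induction k with
      | zero => rfl
      | succ k ih => rw [pow_succ, ih, pow_succ]; rfl
    rw [pow_one, hk, hpow]
    rfl
  have hmod := Equiv.Perm.card_fixedPoints_modEq hf
  rw [Nat.card_eq_fintype_card]
  refine hmod.trans ?_
  rw [show Fintype.card (Function.fixedPoints f) = 1 from ?_]
  rw [Fintype.card_eq_one_iff]
  refine ⟨⟨0, map_zero (ρ h)⟩, fun ⟨w, hw⟩ => ?_⟩
  refine Subtype.ext (?_ : w = 0)
  by_contra hw0
  have hfix : MonoidAlgebra.of F G h * (w : MonoidAlgebra F G) = w := congrArg Subtype.val hw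
  have hone : ρ h = 1 := by
    refine LinearMap.ext fun u => Subtype.ext ?_
    exact mul_eq_self_of_isAtom hI w.2 (by simpa using hw0) hfix u.2
  rw [hone, orderOf_one] at hord
  exact hpp.one_lt.ne hord

variable [Fintype F]

/-- A character of `G` of prime order `p` with values in an algebraically closed field yields a
minimal ideal of the group algebra, distinct from the one generated by the average, whose size is
at most `|F| ^ m` whenever `|F| ^ m ≡ 1` modulo `p`. -/
theorem exists_isAtom_card_le (hn : (Fintype.card G : F) ≠ 0) {p m : ℕ} (hp : p.Prime)
    (hpn : p ∣ Fintype.card G) (hm : 0 < m) (hqm : Fintype.card F ^ m ≡ 1 [MOD p]) :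
    ∃ I : Ideal (MonoidAlgebra F G), IsAtom I ∧
      I ≠ Ideal.span {(Fintype.card G : F)⁻¹ • ∑ x : G, MonoidAlgebra.of F G x} ∧
      Nat.card I ≤ Fintype.card F ^ m := by
  classical
  have : NeZero (Nat.card G : F) := ⟨by rwa [Nat.card_eq_fintype_card]⟩
  have : Fact p.Prime := ⟨hp⟩
  have : NeZero (Monoid.exponent G : F) := ⟨fun h0 => by
    obtain ⟨c, hc⟩ := Group.exponent_dvd_card (G := G)
    apply hn
    rw [hc, Nat.cast_mul, h0, zero_mul]⟩
  let E := AlgebraicClosure F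
  obtain ⟨eqv⟩ := CommGroup.monoidHom_mulEquiv_of_hasEnoughRootsOfUnity G E
  obtain ⟨g, hg⟩ := exists_prime_orderOf_dvd_card p hpn
  let χ : G →* Eˣ := eqv.symm g
  have hχ : orderOf χ = p := by rw [← hg]; exact MulEquiv.orderOf_eq eqv.symm g
  have hχp (x : G) : χ x ^ p = 1 := by
    rw [← MonoidHom.pow_apply, ← hχ, pow_orderOf_eq_one, MonoidHom.one_apply]
  let ψ : G →* E := (Units.coeHom E).comp χ
  have hψ1 : ψ ≠ 1 := by
    intro h
    have : χ = 1 := by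
      ext x
      exact DFunLike.congr_fun h x
    rw [this, orderOf_one] at hχ
    exact hp.one_lt.ne hχ
  let φ : MonoidAlgebra F G →ₐ[F] E := MonoidAlgebra.lift F E G ψ
  have hφ (x : G) : φ (MonoidAlgebra.of F G x) = ψ x := MonoidAlgebra.lift_of _ _
  set Q := Fintype.card F ^ m with hQ
  have hψQ (x : G) : ψ x ^ Q = ψ x := by
    have h1 : χ x ^ Q = χ x ^ 1 :=
      pow_eq_pow_iff_modEq.2 (hqm.of_dvd (orderOf_dvd_of_pow_eq_one (hχp x)))
    rw [pow_one] at h1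
    exact (Units.val_pow_eq_pow_val _ _).symm.trans (congrArg Units.val h1)
  obtain ⟨ℓ, _⟩ := CharP.exists F
  have : Fact ℓ.Prime := ⟨CharP.char_is_prime F ℓ⟩
  have : CharP E ℓ := charP_of_injective_algebraMap (algebraMap F E).injective ℓ
  obtain ⟨s, -, hs⟩ := FiniteField.card F ℓ
  have hφQ (a : MonoidAlgebra F G) : φ a ^ Q = φ a := by
    induction a using MonoidAlgebra.induction_on with
    | of g => rw [hφ, hψQ]
    | add a b ha hb =>
      rw [map_add, hQ, hs, ← pow_mul, add_pow_char_pow, pow_mul, ← hs, ← hQ, ha, hb]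
    | smul r a ha =>
      rw [map_smul, smul_pow, ha, hQ, FiniteField.pow_card_pow]
  have hprime : (RingHom.ker φ).IsPrime := RingHom.ker_isPrime φ
  have : IsArtinianRing (MonoidAlgebra F G) := IsArtinianRing.of_finite F _
  have hmax : (RingHom.ker φ).IsMaximal := IsArtinianRing.isMaximal_of_isPrime _
  obtain ⟨I, hcompl⟩ := exists_isCompl (RingHom.ker φ)
  have hI : IsAtom I := hcompl.symm.isAtom_iff_isCoatom.2 hmax.out
  refine ⟨I, hI, ?_, ?_⟩
  · intro h
    set e : MonoidAlgebra F G := (Fintype.card G : F)⁻¹ • ∑ x : G, MonoidAlgebra.of F G x with he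
    have hker : e ∈ RingHom.ker φ := by
      rw [RingHom.mem_ker, he, map_smul, map_sum, Finset.sum_congr rfl fun x _ => hφ x,
        sum_hom_units_eq_zero ψ hψ1, smul_zero]
    have heI : e ∈ I := h ▸ Ideal.mem_span_singleton_self e
    have he0 : e = 0 := (Submodule.disjoint_def.1 hcompl.disjoint) e hker heI
    apply hI.1
    rw [h, he0]
    simp
  · have hQ1 : 1 < Q := Nat.one_lt_pow hm.ne' Fintype.one_lt_card
    have hne : (Polynomial.X ^ Q - Polynomial.X : Polynomial E) ≠ 0 :=
      FiniteField.X_pow_card_sub_X_ne_zero E hQ1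
    let S : Finset E := (Polynomial.X ^ Q - Polynomial.X : Polynomial E).roots.toFinset
    have hmem (a : MonoidAlgebra F G) : φ a ∈ S := by
      simp [S, Polynomial.mem_roots hne, hφQ]
    have hinj : Function.Injective fun a : I => (⟨φ a, hmem a⟩ : S) := by
      intro a b hab
      have hab' : φ a = φ b := congrArg Subtype.val hab
      have hker : (a - b : MonoidAlgebra F G) ∈ RingHom.ker φ := by
        rw [RingHom.mem_ker, map_sub, hab', sub_self]
      exact Subtype.ext (sub_eq_zero.1
        ((Submodule.disjoint_def.1 hcompl.disjoint) _ hker (I.sub_mem a.2 b.2)))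
    calc Nat.card I ≤ Nat.card S := Nat.card_le_card_of_injective _ hinj
      _ = S.card := by simp
      _ ≤ (Polynomial.X ^ Q - Polynomial.X : Polynomial E).roots.card :=
        Multiset.toFinset_card_le _
      _ ≤ (Polynomial.X ^ Q - Polynomial.X : Polynomial E).natDegree := Polynomial.card_roots' _
      _ = Q := FiniteField.X_pow_card_sub_X_natDegree_eq E hQ1

/-- The cardinality of an ideal of the group algebra in terms of its dimension. -/
theorem card_ideal_eq_pow_finrank (I : Ideal (MonoidAlgebra F G)) :
    Nat.card I = Fintype.card F ^ Module.finrank F (I.restrictScalars F) := by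
  rw [← Nat.card_eq_fintype_card]
  exact Module.natCard_eq_pow_finrank (K := F) (V := I.restrictScalars F)

/-- `μ_q(n)` bounds from below the dimension of every minimal ideal of the group algebra other than
the one generated by the average. -/
theorem muq_le_finrank (h1 : 1 < Fintype.card G) (hn : (Fintype.card G : F) ≠ 0)
    {I : Ideal (MonoidAlgebra F G)} (hI : IsAtom I)
    (hne : I ≠ Ideal.span {(Fintype.card G : F)⁻¹ • ∑ x : G, MonoidAlgebra.of F G x}) :
    muq (Fintype.card F) (Fintype.card G) ≤ Module.finrank F (I.restrictScalars F) := by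
  have : Finite (MonoidAlgebra F G) := Module.finite_of_finite F
  have h := mt (eq_span_average_of_trivial hn hI) hne
  push Not at h
  obtain ⟨g, v, hv, hgv⟩ := h
  obtain ⟨p, hp, hpn, hmod⟩ := exists_prime_card_modEq_one hI hv hgv
  rw [card_ideal_eq_pow_finrank] at hmod
  refine muq_le_of_pow_modEq_one h1 hp hpn ?_ hmod
  rw [Nat.pos_iff_ne_zero, Ne, Submodule.finrank_eq_zero, Submodule.restrictScalars_eq_bot_iff]
  exact hI.1

end GroupAlgebra

/-- for an abelian group `G` of order `n > 1` coprime to `q`, the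
minimum of `dim_F I` over all minimal nonzero ideals `I ≠ F·e₀` of the group
algebra `FG` (where `e₀ = (1/n)·Σ_{x∈G} x`) equals `μ_q(n)`. -/
theorem statement9 (F G : Type) [Field F] [Fintype F] [CommGroup G] [Fintype G]
    (q n : ℕ) (hq : q = Fintype.card F) (hn : n = Fintype.card G)
    (h1 : 1 < n) (hcop : Nat.Coprime n q)
    (e0 : MonoidAlgebra F G)
    (he0 : e0 = (n : F)⁻¹ • ∑ x : G, MonoidAlgebra.of F G x) :
    IsLeast { k : ℕ | ∃ I : Ideal (MonoidAlgebra F G),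
        I ≠ ⊥ ∧ (∀ J : Ideal (MonoidAlgebra F G), J < I → J = ⊥) ∧
        I ≠ Ideal.span {e0} ∧
        Module.finrank F (I.restrictScalars F) = k }
      (muq q n) := by
  subst hq hn he0
  have hn0 : (Fintype.card G : F) ≠ 0 := by
    intro h
    have hco := (Nat.isCoprime_iff_coprime.2 hcop).map (Int.castRingHom F)
    simp [h] at hco
  constructor
  · obtain ⟨a, ha, hcard⟩ := Nat.sInf_mem
      (s := { k | ∃ a : ZMod (Fintype.card G), a ≠ 0 ∧
        {b : ZMod (Fintype.card G) |
          ∃ i : ℕ, b = a * (Fintype.card F : ZMod (Fintype.card G)) ^ i}.ncard = k })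
      (by
        have : Fact (1 < Fintype.card G) := ⟨h1⟩
        exact ⟨_, 1, one_ne_zero, rfl⟩)
    obtain ⟨hm, p, hp, hpn, hmod⟩ := exists_prime_dvd_pow_ncard_coset h1 hcop ha
    rw [hcard] at hm hmod
    obtain ⟨I, hI, hne, hle⟩ := exists_isAtom_card_le hn0 hp hpn hm hmod
    refine ⟨I, hI.1, fun J => hI.2 J, hne, le_antisymm ?_ (muq_le_finrank h1 hn0 hI hne)⟩
    rw [card_ideal_eq_pow_finrank] at hle
    exact (Nat.pow_le_pow_iff_right Fintype.one_lt_card).1 hle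
  · rintro k ⟨I, hbot, hmin, hne, rfl⟩
    exact muq_le_finrank h1 hn0 ⟨hbot, hmin⟩ hne
end

section
/- Let q ≥ 2 be a prime power. Then there exists a sequence of integers n_1, n_2, … with each n_i > 1 coprime to q, n_i → ∞, and lim_{i→∞} (log_q n_i) / μ_q(n_i) = 0. -/
open Filter Asymptotics

theorem isOfFinOrder_natCast_zmod {q p : ℕ} (hp : p.Prime) (hq : 0 < q) (hqp : q < p) :
    IsOfFinOrder (q : ZMod p) := by
  have : Fact p.Prime := ⟨hp⟩
  have hq0 : (q : ZMod p) ≠ 0 := fun h0 ↦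
    absurd (Nat.le_of_dvd hq ((ZMod.natCast_eq_zero_iff q p).1 h0)) (by omega)
  exact isOfFinOrder_iff_pow_eq_one.2
    ⟨p - 1, Nat.sub_pos_of_lt hp.one_lt, ZMod.pow_card_sub_one_eq_one hq0⟩

theorem muq_eq_orderOf {q p : ℕ} (hp : p.Prime) (hq : 0 < q) (hqp : q < p) :
    muq q p = orderOf (q : ZMod p) := by
  have : Fact p.Prime := ⟨hp⟩
  have key (a : ZMod p) (ha : a ≠ 0) :
      {b : ZMod p | ∃ i : ℕ, b = a * (q : ZMod p) ^ i}.ncard = orderOf (q : ZMod p) := by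
    have h : {b : ZMod p | ∃ i : ℕ, b = a * (q : ZMod p) ^ i} =
        (a * ·) '' (Submonoid.powers (q : ZMod p) : Set (ZMod p)) := by
      ext b
      simp [Submonoid.mem_powers_iff, eq_comm]
    rw [h, Set.ncard_image_of_injective _ (mul_right_injective₀ ha)]
    rw [← Nat.card_coe_set_eq]
    exact (Nat.card_congr (finEquivPowers (isOfFinOrder_natCast_zmod hp hq hqp)).symm).trans
      (Nat.card_fin _)
  have h : {k | ∃ a : ZMod p, a ≠ 0 ∧
      {b : ZMod p | ∃ i : ℕ, b = a * (q : ZMod p) ^ i}.ncard = k} = {orderOf (q : ZMod p)} := by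
    ext k
    constructor
    · rintro ⟨a, ha, rfl⟩
      exact key a ha
    · rintro rfl
      exact ⟨1, one_ne_zero, key 1 one_ne_zero⟩
  rw [muq, h, csInf_singleton]

theorem primorial_le_of_orderOf_le {q M T n : ℕ} (hq : 1 < q) (hqM : q ≤ M)
    (h : ∀ p, p.Prime → M < p → p ≤ n → orderOf (q : ZMod p) ≤ T) :
    primorial n ≤ M.factorial * q ^ (T * T) := by
  have hpos (t : ℕ) (ht : t ∈ Finset.Icc 1 T) : 0 < q ^ t - 1 :=
    Nat.sub_pos_of_lt (Nat.one_lt_pow (by grind) hq)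
  have hdvd : primorial n ∣ M.factorial * ∏ t ∈ Finset.Icc 1 T, (q ^ t - 1) := by
    refine Finset.prod_primes_dvd _ (fun p hp ↦ (Finset.mem_filter.1 hp).2.prime) fun p hp ↦ ?_
    obtain ⟨hpn, hp⟩ := Finset.mem_filter.1 hp
    rw [Finset.mem_range, Nat.lt_succ_iff] at hpn
    rcases le_or_gt p M with hpM | hpM
    · exact (hp.dvd_factorial.2 hpM).mul_right _
    have hord := (isOfFinOrder_natCast_zmod hp (by omega) (hqM.trans_lt hpM)).orderOf_pos
    refine (Dvd.dvd.trans ?_ (Finset.dvd_prod_of_mem _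
      (Finset.mem_Icc.2 ⟨hord, h p hp hpM hpn⟩))).mul_left _
    rw [← ZMod.natCast_eq_zero_iff, Nat.cast_sub (Nat.one_le_pow _ _ (by omega))]
    simp [pow_orderOf_eq_one]
  refine (Nat.le_of_dvd (Nat.mul_pos M.factorial_pos (Finset.prod_pos hpos)) hdvd).trans ?_
  gcongr
  calc ∏ t ∈ Finset.Icc 1 T, (q ^ t - 1) ≤ ∏ t ∈ Finset.Icc 1 T, q ^ T := by
        refine Finset.prod_le_prod' fun t ht ↦ (Nat.sub_le _ _).trans ?_
        exact Nat.pow_le_pow_right (by omega) (Finset.mem_Icc.1 ht).2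
    _ = q ^ (T * T) := by simp [pow_mul]

theorem eventually_lt_theta (A B : ℝ) :
    ∀ᶠ n : ℕ in atTop, A + B * Real.log n ^ 2 < Chebyshev.theta n := by
  have hsqrt : (fun x : ℝ ↦ √x * Real.log x) =o[atTop] (id : ℝ → ℝ) := by
    have h := (isBigO_refl Real.sqrt atTop).mul_isLittleO
      (isLittleO_log_rpow_atTop (r := 1 / 2) (by norm_num))
    refine h.congr' EventuallyEq.rfl ?_
    filter_upwards [eventually_ge_atTop 0] with x hx
    rw [← Real.sqrt_eq_rpow, Real.mul_self_sqrt hx, id]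
  have hc : (fun _ : ℝ ↦ A + Real.log 2) =o[atTop] (id : ℝ → ℝ) := isLittleO_const_id_atTop _
  have hsum := ((hc.add (Real.isLittleO_pow_log_id_atTop (n := 2).const_mul_left B)).add
    Real.isLittleO_log_id_atTop).add (hsqrt.const_mul_left 2)
  have hlog2 : 0 < Real.log 2 / 2 := by positivity
  filter_upwards [tendsto_natCast_atTop_atTop.eventually (hsum.bound hlog2),
    eventually_ge_atTop 1] with n hn h1
  have h1' : (1 : ℝ) ≤ n := mod_cast h1
  have hle : Real.log (n + 1) ≤ Real.log 2 + Real.log n := by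
    rw [← Real.log_mul (by norm_num) (by positivity)]
    exact Real.log_le_log (by positivity) (by linarith)
  have hθ := Chebyshev.theta_ge n
  have hn' := (le_abs_self _).trans hn
  simp only [id, Real.norm_eq_abs, abs_of_nonneg (zero_le_one.trans h1')] at hn'
  have : 0 < Real.log 2 / 2 * n := by positivity
  linarith

theorem exists_prime_mul_log_lt_orderOf {q : ℕ} (hq : 1 < q) (K : ℝ) (N : ℕ) :
    ∃ p, p.Prime ∧ N < p ∧ q < p ∧ K * Real.log p < orderOf (q : ZMod p) := by
  wlog hK : 0 ≤ K generalizing K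
  · obtain ⟨p, hp, hN, hqp, h⟩ := this 0 le_rfl
    refine ⟨p, hp, hN, hqp, lt_of_le_of_lt ?_ h⟩
    have := Real.log_natCast_nonneg p
    nlinarith
  by_contra! hcon
  set M := max N q
  obtain ⟨n, hn, h1⟩ := ((eventually_lt_theta (Real.log M.factorial) (K ^ 2 * Real.log q)).and
    (eventually_ge_atTop 1)).exists
  set T := ⌊K * Real.log n⌋₊
  have hT : (T : ℝ) ≤ K * Real.log n :=
    Nat.floor_le (mul_nonneg hK (Real.log_natCast_nonneg n))
  have hprim : primorial n ≤ M.factorial * q ^ (T * T) := by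
    refine primorial_le_of_orderOf_le hq (le_max_right _ _) fun p hp hMp hpn ↦ Nat.le_floor ?_
    refine (hcon p hp ((le_max_left _ _).trans_lt hMp) ((le_max_right _ _).trans_lt hMp)).trans ?_
    have := hp.pos
    gcongr
  have hq0 : (q : ℝ) ≠ 0 := by positivity
  have hθ : Chebyshev.theta n ≤ Real.log M.factorial + T * T * Real.log q := by
    rw [Chebyshev.theta_eq_log_primorial, Nat.floor_natCast]
    calc Real.log (primorial n) ≤ Real.log ((M.factorial * q ^ (T * T) : ℕ) : ℝ) :=
          Real.log_le_log (mod_cast primorial_pos n) (mod_cast hprim)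
      _ = _ := by
          push_cast
          rw [Real.log_mul (mod_cast M.factorial_ne_zero) (pow_ne_zero _ hq0), Real.log_pow]
          push_cast
          rfl
  have hTT : (T * T : ℝ) * Real.log q ≤ (K * Real.log n) * (K * Real.log n) * Real.log q := by
    have := Real.log_natCast_nonneg q
    gcongr
  nlinarith

/-- for any prime power `q` there is a sequence of integers
`n_1, n_2, …`, each `> 1` and coprime to `q`, with `n_i → ∞` and
`log_q(n_i)/μ_q(n_i) → 0`. -/
theorem statement10 (q : ℕ) (hq : IsPrimePow q) :
    ∃ n : ℕ → ℕ,
      (∀ i, 1 < n i ∧ Nat.Coprime (n i) q) ∧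
      Filter.Tendsto n Filter.atTop Filter.atTop ∧
      Filter.Tendsto (fun i => Real.logb q (n i) / (muq q (n i) : ℝ))
        Filter.atTop (nhds 0) := by
  have hq1 := hq.one_lt
  have hlogq : 0 < Real.log q := Real.log_pos (mod_cast hq1)
  choose n hp hN hqn hord using fun i : ℕ ↦
    exists_prime_mul_log_lt_orderOf hq1 ((i + 1) / Real.log q) i
  refine ⟨n, fun i ↦ ⟨(hp i).one_lt, (Nat.coprime_of_lt_prime (by omega) (hqn i) (hp i))⟩,
    tendsto_atTop_mono (fun i ↦ (hN i).le) tendsto_id, ?_⟩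
  refine squeeze_zero (fun i ↦ ?_) (fun i ↦ ?_) tendsto_one_div_add_atTop_nhds_zero_nat
  · exact div_nonneg (div_nonneg (Real.log_natCast_nonneg _) hlogq.le) (Nat.cast_nonneg _)
  · have hlog := Real.log_natCast_nonneg (n i)
    have hpos : (0 : ℝ) < orderOf (q : ZMod (n i)) := lt_of_le_of_lt (by positivity) (hord i)
    rw [muq_eq_orderOf (hp i) (by omega) (hqn i), Real.logb, div_le_div_iff₀ hpos (by positivity)]
    calc Real.log (n i) / Real.log q * (i + 1) = (i + 1) / Real.log q * Real.log (n i) := by ring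
      _ ≤ 1 * orderOf (q : ZMod (n i)) := by linarith [hord i]
end
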